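/- arXiv:1711.00269 — 3 statements merged into one kernel-verified Lean document; each statement's English description precedes it below -/
import Mathlib

section
/- Let p be an odd prime and let K be a field that is complete with respect to a nonarchimedean (ultrametric) norm and is a ℚ_p-algebra whose structure map is an isometry. Let λ ∈ ℤ_p with λ ≡ 1 (mod p) and λ ≠ 1, and let x ∈ K with ‖x − 1‖ < p^{−1/(p−1)} and x ≠ 1. Then the closure in K of the two-sided orbit {x^{λⁿ} : n ∈ ℤ} (powers with p-adic integer exponents defined by the binomial series) is homeomorphic to ℤ_p; in particular, this orbit closure has cardinality 2^{ℵ₀}. -/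
/-- The `p`-adic binomial coefficient `C(μ, n) = (∏_{k=0}^{n-1} (μ - k)) / n!` as an
element of `ℚ_p`. -/
noncomputable def padicBinom (p : ℕ) [Fact p.Prime] (mu : ℤ_[p]) (n : ℕ) : ℚ_[p] :=
  (∏ k ∈ Finset.range n, ((mu : ℚ_[p]) - (k : ℚ_[p]))) / (Nat.factorial n : ℚ_[p])

/-- The power `y^μ := ∑_{n ≥ 0} C(μ, n) (y - 1)ⁿ` with `p`-adic integer exponent `μ`,
defined by the binomial series, for `y` in a normed `ℚ_p`-algebra `K` with `‖y - 1‖ < 1`. -/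
noncomputable def padicPowOf (p : ℕ) [Fact p.Prime] {K : Type*} [NormedField K]
    [Algebra ℚ_[p] K] (mu : ℤ_[p]) (y : K) : K :=
  ∑' n : ℕ, algebraMap ℚ_[p] K (padicBinom p mu n) * (y - 1) ^ n

open Filter Topology

/-- Norm of `(1+t)^p - 1`, and its nonvanishing. -/
lemma aux_norm_pow_sub_one {R : Type*} [NormedCommRing R] [NormOneClass R] [NormMulClass R]
    [IsUltrametricDist R] (x : R) (hx : ‖x - 1‖ < 1) (n : ℕ) : ‖x ^ n - 1‖ ≤ ‖x - 1‖ := by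
  have hx1 : ‖x‖ ≤ 1 := by
    have : x = (x - 1) + 1 := by ring
    rw [this]
    refine (IsUltrametricDist.norm_add_le_max _ _).trans ?_
    simp [hx.le]
  rw [← mul_geom_sum, norm_mul]
  refine mul_le_of_le_one_right (norm_nonneg _) ?_
  refine IsUltrametricDist.norm_sum_le_of_forall_le_of_nonneg zero_le_one fun i _ => ?_
  rw [norm_pow]
  exact pow_le_one₀ (norm_nonneg _) hx1

lemma aux_root_p {R : Type*} [NormedCommRing R] [NormOneClass R] [NormMulClass R]
    [IsUltrametricDist R] (p : ℕ) (hp : p.Prime) (x : R) (hx : ‖x - 1‖ < 1)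
    (hx2 : ‖x - 1‖ ^ (p - 1) < ‖(p : R)‖) (h : x ^ p = 1) : x = 1 := by
  by_contra hne
  set t := x - 1 with ht
  have ht0 : 0 < ‖t‖ := norm_pos_iff.mpr (sub_ne_zero.mpr hne)
  have hp0 : 0 < ‖(p : R)‖ := lt_of_le_of_lt (by positivity) hx2
  have hxt : x = t + 1 := by rw [ht]; ring
  obtain ⟨m, rfl⟩ : ∃ m, p = m + 2 := ⟨p - 2, by have := hp.two_le; omega⟩
  rw [hxt, add_pow, Finset.sum_range_succ', Finset.sum_range_succ'] at h
  simp only [one_pow, mul_one, pow_zero, Nat.choose_zero_right, Nat.cast_one, zero_add, pow_one,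
    Nat.choose_one_right, add_eq_right] at h
  have hlt : ‖∑ k ∈ Finset.range (m + 1), t ^ (k + 1 + 1) * (((m + 2).choose (k + 1 + 1) : ℕ) : R)‖
      < ‖t * ((m + 2 : ℕ) : R)‖ := by
    obtain ⟨i, hi, hle⟩ := IsUltrametricDist.exists_norm_finsetSum_le_of_nonempty
      (Finset.nonempty_range_iff.mpr (Nat.succ_ne_zero m))
      (fun k => t ^ (k + 1 + 1) * (((m + 2).choose (k + 1 + 1) : ℕ) : R))
    refine lt_of_le_of_lt hle ?_
    rw [norm_mul, norm_mul, norm_pow]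
    have hi' := Finset.mem_range.mp hi
    rcases (Nat.lt_succ_iff.mp hi').eq_or_lt with rfl | hi2
    · simp only [Nat.choose_self, Nat.cast_one, norm_one, mul_one]
      rw [pow_succ']
      exact mul_lt_mul_of_pos_left hx2 ht0
    · obtain ⟨c, hc⟩ := hp.dvd_choose_self (k := i + 1 + 1) (by omega) (by omega)
      rw [hc, Nat.cast_mul, norm_mul, pow_succ']
      have h1 : ‖(c : R)‖ ≤ 1 := IsUltrametricDist.norm_natCast_le_one R c
      have h2 : ‖t‖ ^ (i + 1) < 1 := pow_lt_one₀ ht0.le hx (by omega)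
      calc ‖t‖ * ‖t‖ ^ (i + 1) * (‖((m + 2 : ℕ) : R)‖ * ‖(c : R)‖)
          = (‖t‖ * ‖((m + 2 : ℕ) : R)‖) * (‖t‖ ^ (i + 1) * ‖(c : R)‖) := by ring
        _ < (‖t‖ * ‖((m + 2 : ℕ) : R)‖) * 1 := by
            refine mul_lt_mul_of_pos_left ?_ (by positivity)
            exact lt_of_le_of_lt (mul_le_of_le_one_right (by positivity) h1) h2
        _ = _ := mul_one _
  rw [eq_neg_of_add_eq_zero_left h, norm_neg] at hlt
  exact lt_irrefl _ hlt

lemma aux_root_pk {R : Type*} [NormedCommRing R] [NormOneClass R] [NormMulClass R]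
    [IsUltrametricDist R] (p : ℕ) (hp : p.Prime) (k : ℕ) : ∀ (x : R) (_ : ‖x - 1‖ < 1)
    (_ : ‖x - 1‖ ^ (p - 1) < ‖(p : R)‖) (_ : x ^ p ^ k = 1), x = 1 := by
  induction k with
  | zero => intro x _ _ h; simpa using h
  | succ k ih =>
    intro x hx hx2 h
    have hle := aux_norm_pow_sub_one x hx p
    refine aux_root_p p hp x hx hx2 (ih (x ^ p) (hle.trans_lt hx) ?_ ?_)
    · exact (pow_le_pow_left₀ (norm_nonneg _) hle _).trans_lt hx2
    · rw [← pow_mul, ← pow_succ', h]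

/-- A continuous character with small value at `1` is injective. -/
lemma aux_char_inj {p : ℕ} [hp : Fact p.Prime] {R : Type*} [NormedCommRing R] [NormOneClass R]
    [NormMulClass R] [IsUltrametricDist R] (κ : AddChar ℤ_[p] R) (hκ : Continuous κ)
    (h1 : ‖κ 1 - 1‖ < 1) (h2 : ‖κ 1 - 1‖ ^ (p - 1) < ‖(p : R)‖) (hne : κ 1 ≠ 1) :
    Function.Injective κ := by
  have key : ∀ m : ℤ_[p], κ m = 1 → m = 0 := by
    intro m hm
    by_contra hm0
    have hsm : ∀ a : ℤ_[p], κ (a * m) = 1 := by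
      intro a
      refine congr_fun (PadicInt.denseRange_natCast.equalizer
        (g := fun a : ℤ_[p] => κ (a * m)) (h := fun _ => (1 : R))
        (by fun_prop) continuous_const (funext fun n => ?_)) a
      simp [← nsmul_eq_mul, AddChar.map_nsmul_eq_pow, hm]
    have hspec := PadicInt.unitCoeff_spec hm0
    have h3 := hsm ((PadicInt.unitCoeff hm0)⁻¹ : ℤ_[p]ˣ)
    have h5 : (((PadicInt.unitCoeff hm0)⁻¹ : ℤ_[p]ˣ) : ℤ_[p]) * m = (p : ℤ_[p]) ^ m.valuation :=
      (Units.inv_mul_eq_iff_eq_mul _).mpr hspec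
    rw [h5] at h3
    have h4 : κ 1 ^ p ^ m.valuation = 1 := by
      rw [← AddChar.map_nsmul_eq_pow, nsmul_eq_mul, mul_one, Nat.cast_pow]
      exact h3
    exact hne (aux_root_pk p hp.out _ _ h1 h2 h4)
  intro a b hab
  have hb : κ b * κ (-b) = 1 := by rw [← AddChar.map_add_eq_mul]; simp
  have : κ (a - b) = 1 := by
    rw [sub_eq_add_neg, AddChar.map_add_eq_mul, hab, hb]
  exact sub_eq_zero.mp (key _ this)

lemma aux_card (p : ℕ) [Fact p.Prime] : Cardinal.mk ℤ_[p] = Cardinal.continuum := by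
  apply le_antisymm
  · obtain ⟨f, -, hf⟩ := exists_nat_bool_continuous_surjective_of_compact ℤ_[p]
    simpa using Cardinal.mk_le_of_surjective hf
  · have h := continuum_le_cardinal_of_nontriviallyNormedField ℚ_[p]
    have hs : Metric.closedBall (0 : ℚ_[p]) 1 ∈ 𝓝 (0 : ℚ_[p]) :=
      Metric.closedBall_mem_nhds _ one_pos
    rw [← cardinal_eq_of_mem_nhds ℚ_[p] hs] at h
    refine h.trans (Cardinal.mk_le_of_injective
      (f := fun y => (⟨y.1, mem_closedBall_zero_iff.mp y.2⟩ : ℤ_[p])) ?_)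
    intro a b hab
    exact Subtype.ext (congrArg (fun z : ℤ_[p] => (z : ℚ_[p])) hab)

lemma aux_binom (p : ℕ) [Fact p.Prime] (mu : ℤ_[p]) (n : ℕ) :
    ((Ring.choose mu n : ℤ_[p]) : ℚ_[p]) = padicBinom p mu n := by
  have h := Ring.descPochhammer_eq_factorial_smul_choose mu n
  rw [← Polynomial.aeval_eq_smeval, ← Polynomial.eval_map_algebraMap, algebraMap_int_eq,
    descPochhammer_map, descPochhammer_eval_eq_prod_range, nsmul_eq_mul] at h
  have h' := congrArg (fun z : ℤ_[p] => (z : ℚ_[p])) h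
  unfold padicBinom
  rw [eq_div_iff (by exact_mod_cast n.factorial_ne_zero), mul_comm]
  simp only [PadicInt.coe_mul, PadicInt.coe_natCast] at h'
  rw [← h']
  have := map_prod (PadicInt.Coe.ringHom (p := p)) (fun j : ℕ => mu - (j : ℤ_[p])) (Finset.range n)
  refine this.trans (Finset.prod_congr rfl fun j _ => ?_)
  change ((mu - (j : ℤ_[p]) : ℤ_[p]) : ℚ_[p]) = _
  push_cast
  rfl

lemma aux_pow_eq (p : ℕ) [Fact p.Prime] {K : Type*} [NormedField K]
    [CompleteSpace K] [IsUltrametricDist K] [Algebra ℚ_[p] K]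
    (hiso : ∀ q : ℚ_[p], ‖algebraMap ℚ_[p] K q‖ = ‖q‖) (x : K) (hx : ‖x - 1‖ < 1) :
    ∃ κ : AddChar ℤ_[p] K, Continuous κ ∧ κ 1 = x ∧ ∀ mu, κ mu = padicPowOf p mu x := by
  let : Algebra ℤ_[p] K := ((algebraMap ℚ_[p] K).comp (PadicInt.Coe.ringHom (p := p))).toAlgebra
  have hsm : ∀ (a : ℤ_[p]) (y : K), a • y = algebraMap ℚ_[p] K (a : ℚ_[p]) * y :=
    fun a y => Algebra.smul_def a y
  have : IsBoundedSMul ℤ_[p] K := IsBoundedSMul.of_norm_smul_le fun a y => by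
    rw [hsm, norm_mul, hiso]; rfl
  have hr := tendsto_pow_atTop_nhds_zero_iff_norm_lt_one.mpr hx
  refine ⟨PadicInt.addChar_of_value_at_one (x - 1) hr,
    PadicInt.continuous_addChar_of_value_at_one hr, by simp, fun mu => ?_⟩
  rw [PadicInt.coe_addChar_of_value_at_one, PadicInt.mahlerSeries_apply hr]
  unfold padicPowOf
  refine tsum_congr fun n => ?_
  rw [hsm, mahler_apply, aux_binom]

/-- Let `p` be an odd prime, `λ ∈ ℤ_p` with `λ ≡ 1 (mod p)`, `λ ≠ 1`, and let `x ∈ K`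
with `‖x - 1‖ < p^{-1/(p-1)}` and `x ≠ 1`. Then the closure of the two-sided orbit
`{x^{λⁿ} : n ∈ ℤ}` is homeomorphic to `ℤ_p`; in particular it has cardinality `2^ℵ₀`. -/
theorem stmt_5 (p : ℕ) [Fact p.Prime] (hp : p ≠ 2) {K : Type*} [NormedField K]
    [CompleteSpace K] [IsUltrametricDist K] [Algebra ℚ_[p] K]
    (hiso : ∀ q : ℚ_[p], ‖algebraMap ℚ_[p] K q‖ = ‖q‖)
    (lam : ℤ_[p]) (hcong : (p : ℤ_[p]) ∣ (lam - 1)) (hne : lam ≠ 1)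
    (x : K) (hx : ‖x - 1‖ < (p : ℝ) ^ (-(1 : ℝ) / ((p : ℝ) - 1))) (hxne : x ≠ 1)
    (u : ℤ_[p]ˣ) (hu : (u : ℤ_[p]) = lam) :
    Nonempty
      ((closure {y : K | ∃ n : ℤ, y = padicPowOf p ((u ^ n : ℤ_[p]ˣ) : ℤ_[p]) x}) ≃ₜ ℤ_[p]) ∧
    Cardinal.mk
      ↥(closure {y : K | ∃ n : ℤ, y = padicPowOf p ((u ^ n : ℤ_[p]ˣ) : ℤ_[p]) x}) =
      2 ^ Cardinal.aleph0 := by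
  have hprime : p.Prime := Fact.out
  have hp3 : 3 ≤ p := by
    have := hprime.two_le
    omega
  have hpR : (0 : ℝ) < p := by positivity
  have hp1 : (1 : ℝ) < p := by exact_mod_cast hprime.one_lt
  have hcast : ((p - 1 : ℕ) : ℝ) = (p : ℝ) - 1 := by
    rw [Nat.cast_sub hprime.one_le]; simp
  -- estimates for x
  have hx1 : ‖x - 1‖ < 1 := hx.trans (Real.rpow_lt_one_of_one_lt_of_neg hp1
    (div_neg_of_neg_of_pos (by norm_num) (by linarith)))
  have hpK : ‖(p : K)‖ = (p : ℝ)⁻¹ := by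
    rw [← map_natCast (algebraMap ℚ_[p] K) p, hiso, Padic.norm_p]
  have hx2 : ‖x - 1‖ ^ (p - 1) < ‖(p : K)‖ := by
    rw [hpK]
    refine (pow_lt_pow_left₀ hx (norm_nonneg _) (by omega)).trans_eq ?_
    rw [← Real.rpow_natCast, ← Real.rpow_mul hpR.le, hcast,
      div_mul_cancel₀ _ (by linarith), Real.rpow_neg_one]
  obtain ⟨κ, hκc, hκ1, hκ⟩ := aux_pow_eq p hiso x hx1
  have hκi : Function.Injective κ := aux_char_inj κ hκc (by rw [hκ1]; exact hx1)
    (by rw [hκ1]; exact hx2) (by rw [hκ1]; exact hxne)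
  -- the character for lam
  have hl1 : ‖lam - 1‖ < 1 := (PadicInt.norm_lt_one_iff_dvd _).mpr hcong
  have hl2 : ‖lam - 1‖ ^ (p - 1) < ‖(p : ℤ_[p])‖ := by
    obtain ⟨c, hc⟩ := hcong
    have h1 : ‖lam - 1‖ ≤ (p : ℝ)⁻¹ := by
      rw [hc, norm_mul, PadicInt.norm_p]
      exact mul_le_of_le_one_right (by positivity) (PadicInt.norm_le_one c)
    rw [PadicInt.norm_p]
    refine (pow_le_pow_left₀ (norm_nonneg _) h1 _).trans_lt ?_
    exact pow_lt_self_of_lt_one₀ (by positivity) (inv_lt_one_of_one_lt₀ hp1) (by omega)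
  have hrl := tendsto_pow_atTop_nhds_zero_iff_norm_lt_one.mpr hl1
  obtain ⟨χ, hχc, hχ1⟩ : ∃ χ : AddChar ℤ_[p] ℤ_[p], Continuous χ ∧ χ 1 = lam :=
    ⟨PadicInt.addChar_of_value_at_one (lam - 1) hrl,
      PadicInt.continuous_addChar_of_value_at_one hrl, by simp⟩
  have hχi : Function.Injective χ := aux_char_inj χ hχc (by rw [hχ1]; exact hl1)
    (by rw [hχ1]; exact hl2) (by rw [hχ1]; exact hne)
  have hχnat : ∀ n : ℕ, χ (n : ℤ_[p]) = ((u ^ n : ℤ_[p]ˣ) : ℤ_[p]) := by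
    intro n
    have := AddChar.map_nsmul_eq_pow χ n 1
    rw [nsmul_eq_mul, mul_one] at this
    rw [this, hχ1, Units.val_pow_eq_pow_val, hu]
  have hχint : ∀ n : ℤ, χ (n : ℤ_[p]) = ((u ^ n : ℤ_[p]ˣ) : ℤ_[p]) := by
    intro n
    obtain ⟨m, rfl | rfl⟩ := n.eq_nat_or_neg
    · simpa using hχnat m
    · have h : χ (-(m : ℤ_[p])) * χ (m : ℤ_[p]) = 1 := by
        rw [← AddChar.map_add_eq_mul]; simp
      rw [hχnat] at h
      rw [zpow_neg, zpow_natCast, Int.cast_neg, Int.cast_natCast]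
      exact Units.eq_inv_of_mul_eq_one_left ((mul_comm _ _).trans h)
  have hemb : IsClosedEmbedding (κ ∘ χ) :=
    (hκc.comp hχc).isClosedEmbedding (hκi.comp hχi)
  have hset : {y : K | ∃ n : ℤ, y = padicPowOf p ((u ^ n : ℤ_[p]ˣ) : ℤ_[p]) x}
      = (κ ∘ χ) '' Set.range (Int.cast : ℤ → ℤ_[p]) := by
    ext y
    simp only [Set.mem_ofPred_eq, Set.mem_image, Set.mem_range, exists_exists_eq_and,
      Function.comp_apply, hχint, hκ]
    exact exists_congr fun n => eq_comm
  have hcl : closure {y : K | ∃ n : ℤ, y = padicPowOf p ((u ^ n : ℤ_[p]ˣ) : ℤ_[p]) x}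
      = Set.range (κ ∘ χ) := by
    rw [hset, hemb.closure_image_eq, PadicInt.denseRange_intCast.closure_range, Set.image_univ]
  rw [hcl]
  refine ⟨⟨hemb.isEmbedding.toHomeomorph.symm⟩, ?_⟩
  have h := Cardinal.mk_range_eq_of_injective hemb.injective
  rw [aux_card] at h
  simpa using h
end

section
/- Let V be a set, G a simple graph on V, and b : V → ℕ a function such that: (i) for every vertex v with b(v) > 0, every neighbor w of v satisfies b(w) = b(v) − 1 or b(w) = b(v) + 1; and (ii) every vertex v with b(v) > 0 has exactly one neighbor w with b(w) = b(v) − 1. Then every cycle of G lies entirely in the level-0 set: if c is a closed walk in G which is a cycle (no repeated edges, and no repeated vertices except that the endpoints coincide), then every vertex in the support of c satisfies b = 0. -/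
/-- Let `G` be a simple graph on `V` and `b : V → ℕ` a level function such that
(i) every neighbor of a vertex `v` with `b v > 0` is at level `b v - 1` or `b v + 1`, and
(ii) every vertex `v` with `b v > 0` has exactly one neighbor at level `b v - 1`.
Then every cycle of `G` lies entirely in the level-`0` set. -/
theorem stmt_6 {V : Type*} (G : SimpleGraph V) (b : V → ℕ)
    (h1 : ∀ v w : V, G.Adj v w → 0 < b v → b w + 1 = b v ∨ b w = b v + 1)
    (h2 : ∀ v : V, 0 < b v → ∃! w : V, G.Adj v w ∧ b w + 1 = b v)
    (v : V) (c : G.Walk v v) (hc : c.IsCycle) :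
    ∀ w ∈ c.support, b w = 0 := by
  classical
  obtain ⟨m, hm, hmax⟩ := c.support.toFinset.exists_max_image b
    ⟨v, by simp⟩
  have hm' : m ∈ c.support := by simpa using hm
  intro w hw
  have hle := hmax w (by simpa using hw)
  by_contra hne
  have hpos : 0 < b m := by omega
  obtain ⟨x, y, hxy, hs⟩ := Set.ncard_eq_two.mp (hc.ncard_neighborSet_toSubgraph_eq_two hm')
  have key : ∀ z ∈ c.toSubgraph.neighborSet m, G.Adj m z ∧ b z + 1 = b m := by
    intro z hz
    have hadj : c.toSubgraph.Adj m z := hz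
    have hz' : z ∈ c.support := by
      rw [← SimpleGraph.Walk.mem_verts_toSubgraph]
      exact hadj.snd_mem
    have hzm := hmax z (by simpa using hz')
    refine ⟨hadj.adj_sub, ?_⟩
    rcases h1 m z hadj.adj_sub hpos with h | h <;> omega
  exact hxy ((h2 m hpos).unique (key x (by simp [hs])) (key y (by simp [hs])))
end

section
/- Let p be a prime, W = W(𝔽_{p²}) the ring of p-typical Witt vectors of the field with p² elements, and σ : W → W the Witt-vector Frobenius. For every x ∈ W there exists a unit a ∈ W^× such that a·σ(a)·(1 − p·x·σ(x)) = 1. (In particular, the matrix [[a, p·σ(x·a)], [x·a, σ(a)]] has determinant 1 and its Möbius transformation sends the point w = 0 to w = x, so the determinant-one matrices of the form [[a, pσ(b)],[b, σ(a)]] act transitively on the open unit disc of W.) -/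
lemma galois_frob_sq (p : ℕ) [Fact p.Prime] (t : GaloisField p 2) : (t ^ p) ^ p = t := by
  have : Fintype (GaloisField p 2) := Fintype.ofFinite _
  have hc : Fintype.card (GaloisField p 2) = p ^ 2 := by
    rw [← Nat.card_eq_fintype_card]; exact GaloisField.card p 2 (by norm_num)
  have := FiniteField.pow_card t
  rw [hc] at this
  rw [← pow_mul, ← sq, this]

lemma exists_trace_ne_zero (p : ℕ) [Fact p.Prime] : ∃ t : GaloisField p 2, t + t ^ p ≠ 0 := by
  classical
  have hp : p.Prime := Fact.out
  have : Fintype (GaloisField p 2) := Fintype.ofFinite _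
  have hc : Fintype.card (GaloisField p 2) = p ^ 2 := by
    rw [← Nat.card_eq_fintype_card]; exact GaloisField.card p 2 (by norm_num)
  by_contra! h
  let f : Polynomial (GaloisField p 2) := Polynomial.X ^ p + Polynomial.X
  have hdeg : f.natDegree = p := by
    have := hp.one_lt
    rw [Polynomial.natDegree_add_eq_left_of_natDegree_lt] <;> simp [this]
  have h0 : f = 0 := by
    apply Polynomial.eq_zero_of_natDegree_lt_card_of_eval_eq_zero' f Finset.univ
    · intro t _
      simpa [f, add_comm] using h t
    · rw [hdeg, Finset.card_univ, hc]
      nlinarith [hp.one_lt]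
  rw [h0] at hdeg
  simp at hdeg
  exact hp.ne_zero hdeg.symm

theorem stmt_17 (p : ℕ) [Fact p.Prime] (x : WittVector p (GaloisField p 2)) :
    ∃ a : (WittVector p (GaloisField p 2))ˣ,
      (a : WittVector p (GaloisField p 2)) *
          WittVector.frobenius (a : WittVector p (GaloisField p 2)) *
          (1 - (p : WittVector p (GaloisField p 2)) * x * WittVector.frobenius x) = 1 := by
  have hp : p.Prime := Fact.out
  obtain ⟨t, ht⟩ := exists_trace_ne_zero p
  have ht0 : t ≠ 0 := by
    rintro rfl
    simp [hp.ne_zero] at ht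
  have hss : ∀ y : WittVector p (GaloisField p 2),
      WittVector.frobenius (WittVector.frobenius y) = y := by
    intro y
    ext n
    rw [WittVector.coeff_frobenius_charP, WittVector.coeff_frobenius_charP, galois_frob_sq]
  set σ : WittVector p (GaloisField p 2) →+* WittVector p (GaloisField p 2) :=
    WittVector.frobenius with hσ
  have hcσ : ∀ y, WittVector.constantCoeff (σ y) = (WittVector.constantCoeff y) ^ p := by
    intro y
    exact WittVector.coeff_frobenius_charP p y 0
  have hcu : ∀ y : WittVector p (GaloisField p 2), WittVector.constantCoeff y ≠ 0 → IsUnit y :=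
    fun y hy => WittVector.isUnit_of_coeff_zero_ne_zero y hy
  have hmem : ∀ y : WittVector p (GaloisField p 2),
      y ∈ Ideal.span {(p : WittVector p (GaloisField p 2))} ↔ WittVector.constantCoeff y = 0 :=
    fun y => WittVector.mem_span_p_iff_coeff_zero_eq_zero y
  set u := 1 - (p : WittVector p (GaloisField p 2)) * x * σ x with hu
  have hσu : σ u = u := by
    rw [hu]; simp only [map_sub, map_one, map_mul, map_natCast, hss]; ring
  have hcu1 : WittVector.constantCoeff u = 1 := by
    rw [hu, map_sub, map_mul, map_mul, map_natCast, map_one, CharP.cast_eq_zero]; ring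
  let y := WittVector.teichmuller p t
  have hy : WittVector.constantCoeff y = t := WittVector.teichmuller_coeff_zero p t
  have hinv : ∀ m, WittVector.constantCoeff m ≠ 0 → σ m = m → ∃ i, i * m = 1 ∧ σ i = i := by
    intro m hm hs
    obtain ⟨i, hi⟩ := (hcu m hm).exists_left_inv
    refine ⟨i, hi, ?_⟩
    have h2 : σ i * m = 1 := by
      have := congrArg σ hi
      rwa [map_mul, map_one, hs] at this
    calc σ i = σ i * (i * m) := by rw [hi, mul_one]
      _ = i * (σ i * m) := by ring
      _ = i := by rw [h2, mul_one]
  obtain ⟨i, hi, hσi⟩ := hinv (y * σ y)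
    (by rw [map_mul, hcσ, hy]; exact mul_ne_zero ht0 (pow_ne_zero _ ht0))
    (by rw [map_mul, hss, mul_comm])
  obtain ⟨j, hj, hσj⟩ := hinv u (by rw [hcu1]; exact one_ne_zero) hσu
  obtain ⟨b, hb⟩ : ∃ b, b = (y + σ y) * i := ⟨_, rfl⟩
  obtain ⟨c, hc⟩ : ∃ c, c = i * j * (u - 1) := ⟨_, rfl⟩
  have hσb : σ b = b := by
    rw [hb, map_mul, map_add, hss, hσi, add_comm]
  have hσc : σ c = c := by
    rw [hc]; simp only [map_mul, map_sub, map_one, hσi, hσj, hσu]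
  have hci : WittVector.constantCoeff i ≠ 0 := by
    intro h
    have := congrArg WittVector.constantCoeff hi
    rw [map_mul, h, zero_mul, map_one] at this
    exact zero_ne_one this
  have hcb : WittVector.constantCoeff b ≠ 0 := by
    rw [hb, map_mul, map_add, hcσ, hy]
    exact mul_ne_zero ht hci
  have hcc : WittVector.constantCoeff c = 0 := by
    rw [hc, map_mul, map_sub, hcu1, map_one, sub_self, mul_zero]
  let f : Polynomial (WittVector p (GaloisField p 2)) :=
    Polynomial.X ^ 2 + (Polynomial.C b * Polynomial.X + Polynomial.C c)
  have hf : f.Monic := by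
    apply Polynomial.monic_X_pow_add
    exact lt_of_le_of_lt Polynomial.degree_linear_le (by norm_num)
  obtain ⟨w, hw, hw0⟩ := HenselianRing.is_henselian
    (I := Ideal.span {(p : WittVector p (GaloisField p 2))}) f hf 0
    (by rw [hmem]; simp [f, hcc])
    (by
      have : Polynomial.eval 0 (Polynomial.derivative f) = b := by simp [f]
      rw [this]
      exact (hcu b hcb).map _)
  rw [sub_zero, hmem] at hw0
  have hweq : w ^ 2 + b * w + c = 0 := by
    have : Polynomial.eval w f = 0 := hw
    simp only [f, Polynomial.eval_add, Polynomial.eval_pow, Polynomial.eval_mul,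
      Polynomial.eval_X, Polynomial.eval_C] at this
    rw [← this]; ring
  have hweq2 : (σ w) ^ 2 + b * σ w + c = 0 := by
    have := congrArg σ hweq
    simpa only [map_add, map_mul, map_pow, hσb, hσc, map_zero] using this
  have hσw : σ w = w := by
    have h1 : (σ w - w) * (σ w + w + b) = 0 := by linear_combination hweq2 - hweq
    rcases mul_eq_zero.mp h1 with h | h
    · exact sub_eq_zero.mp h
    · exfalso
      have := congrArg WittVector.constantCoeff h
      rw [map_add, map_add, hcσ, hw0, zero_pow hp.ne_zero, map_zero, add_zero, zero_add] at this
      exact hcb this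
  have key : (1 + w * y) * σ (1 + w * y) * u = 1 := by
    rw [map_add, map_one, map_mul, hσw]
    rw [hb, hc] at hweq
    linear_combination (y * σ y * u) * hweq - (w * (y + σ y) * u + (u - 1) * j * u) * hi
      - (u - 1) * hj
  have hunit : IsUnit (1 + w * y) := by
    apply IsUnit.of_mul_eq_one (σ (1 + w * y) * u)
    rw [← mul_assoc]; exact key
  exact ⟨hunit.unit, key⟩
end
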